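/- Let U ⊆ ℂⁿ be open, φ ∈ C^∞(U,ℝ), k > 0 and c > 0, and assume ∑_{j,ℓ=1}^n (∂²φ/∂z_j∂z̄_ℓ)(z) w_j w̄_ℓ ≥ c|w|² for all z ∈ U and w ∈ ℂⁿ. Then for every u = (u_1,…,u_n) with each u_j ∈ C_c^∞(U,ℂ): ∑_{1≤j<ℓ≤n} ∫_U | ∂u_ℓ/∂z̄_j − ∂u_j/∂z̄_ℓ |² e^{−2kφ} dλ + ∫_U | ∑_{j=1}^n ( ∂u_j/∂z_j − 2k (∂φ/∂z_j) u_j ) |² e^{−2kφ} dλ ≥ 2kc ∑_{j=1}^n ∫_U |u_j|² e^{−2kφ} dλ. -/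

import Mathlib

open MeasureTheory Complex ComplexConjugate
open scoped ENNReal

/-- The Wirtinger derivative `∂/∂z_j`. -/
noncomputable def wD {n : ℕ} (j : Fin n) (f : (Fin n → ℂ) → ℂ) : (Fin n → ℂ) → ℂ :=
  fun z => (fderiv ℝ f z (Pi.single j 1) - Complex.I * fderiv ℝ f z (Pi.single j Complex.I)) / 2

/-- The Wirtinger derivative `∂/∂z̄_j`. -/
noncomputable def wDbar {n : ℕ} (j : Fin n) (f : (Fin n → ℂ) → ℂ) : (Fin n → ℂ) → ℂ :=
  fun z => (fderiv ℝ f z (Pi.single j 1) + Complex.I * fderiv ℝ f z (Pi.single j Complex.I)) / 2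

section Wirtinger

variable {n : ℕ} {f g : (Fin n → ℂ) → ℂ} {z : Fin n → ℂ}

lemma ContDiff.wD (hf : ContDiff ℝ (⊤ : ℕ∞) f) (j : Fin n) :
    ContDiff ℝ (⊤ : ℕ∞) (wD j f) := by
  have h : ContDiff ℝ (⊤ : ℕ∞) (fderiv ℝ f) := hf.fderiv_right (by simp)
  unfold _root_.wD
  fun_prop

lemma ContDiff.wDbar (hf : ContDiff ℝ (⊤ : ℕ∞) f) (j : Fin n) :
    ContDiff ℝ (⊤ : ℕ∞) (wDbar j f) := by
  have h : ContDiff ℝ (⊤ : ℕ∞) (fderiv ℝ f) := hf.fderiv_right (by simp)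
  unfold _root_.wDbar
  fun_prop

lemma wD_eq_zero_of_notMem_tsupport (j : Fin n) (hz : z ∉ tsupport f) : wD j f z = 0 := by
  have h : fderiv ℝ f z = 0 :=
    Function.notMem_support.1 fun h => hz (support_fderiv_subset ℝ h)
  simp [wD, h]

lemma wDbar_eq_zero_of_notMem_tsupport (j : Fin n) (hz : z ∉ tsupport f) : wDbar j f z = 0 := by
  have h : fderiv ℝ f z = 0 :=
    Function.notMem_support.1 fun h => hz (support_fderiv_subset ℝ h)
  simp [wDbar, h]

lemma Filter.EventuallyEq.wD_eq (h : f =ᶠ[nhds z] g) (j : Fin n) : wD j f z = wD j g z := by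
  simp [wD, h.fderiv_eq]

lemma Filter.EventuallyEq.wDbar (h : f =ᶠ[nhds z] g) (j : Fin n) :
    wDbar j f =ᶠ[nhds z] wDbar j g := by
  filter_upwards [h.fderiv (𝕜 := ℝ)] with y hy
  simp [_root_.wDbar, hy]

lemma wD_mul (j : Fin n) (hf : DifferentiableAt ℝ f z) (hg : DifferentiableAt ℝ g z) :
    wD j (fun y => f y * g y) z = wD j f z * g z + f z * wD j g z := by
  simp only [wD, fderiv_fun_mul hf hg, _root_.add_apply,
    _root_.smul_apply, smul_eq_mul]
  ring

lemma wDbar_mul (j : Fin n) (hf : DifferentiableAt ℝ f z) (hg : DifferentiableAt ℝ g z) :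
    wDbar j (fun y => f y * g y) z = wDbar j f z * g z + f z * wDbar j g z := by
  simp only [wDbar, fderiv_fun_mul hf hg, _root_.add_apply,
    _root_.smul_apply, smul_eq_mul]
  ring

lemma wDbar_sub (j : Fin n) (hf : DifferentiableAt ℝ f z) (hg : DifferentiableAt ℝ g z) :
    wDbar j (fun y => f y - g y) z = wDbar j f z - wDbar j g z := by
  simp only [wDbar, fderiv_fun_sub hf hg, _root_.sub_apply]
  ring

lemma wDbar_const_mul (j : Fin n) (a : ℂ) (hf : DifferentiableAt ℝ f z) :
    wDbar j (fun y => a * f y) z = a * wDbar j f z := by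
  simp only [wDbar, fderiv_const_mul hf, _root_.smul_apply, smul_eq_mul]
  ring

lemma fderiv_conj_apply (hf : DifferentiableAt ℝ f z) (v : Fin n → ℂ) :
    fderiv ℝ (fun y => conj (f y)) z v = conj (fderiv ℝ f z v) := by
  have h : HasFDerivAt (fun y => conj (f y)) _ z :=
    (conjCLE.toContinuousLinearMap.hasFDerivAt).comp z hf.hasFDerivAt
  rw [h.fderiv]
  simp

lemma wD_conj (j : Fin n) (hf : DifferentiableAt ℝ f z) :
    wD j (fun y => conj (f y)) z = conj (wDbar j f z) := by
  simp only [wD, wDbar, fderiv_conj_apply hf, map_div₀, map_add, map_mul, conj_I, map_ofNat]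
  ring

lemma wDbar_conj (j : Fin n) (hf : DifferentiableAt ℝ f z) :
    wDbar j (fun y => conj (f y)) z = conj (wD j f z) := by
  simp only [wD, wDbar, fderiv_conj_apply hf, map_div₀, map_sub, map_mul, conj_I, map_ofNat]
  ring

lemma fderiv_cexp_const_mul_apply (a : ℂ) (hf : DifferentiableAt ℝ f z) (v : Fin n → ℂ) :
    fderiv ℝ (fun y => cexp (a * f y)) z v = a * fderiv ℝ f z v * cexp (a * f z) := by
  rw [(hf.const_mul a).hasFDerivAt.cexp.fderiv, fderiv_const_mul hf]
  simp only [_root_.smul_apply, smul_eq_mul]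
  ring

lemma wD_cexp_const_mul (j : Fin n) (a : ℂ) (hf : DifferentiableAt ℝ f z) :
    wD j (fun y => cexp (a * f y)) z = a * wD j f z * cexp (a * f z) := by
  simp only [wD, fderiv_cexp_const_mul_apply a hf]
  ring

lemma wDbar_cexp_const_mul (j : Fin n) (a : ℂ) (hf : DifferentiableAt ℝ f z) :
    wDbar j (fun y => cexp (a * f y)) z = a * wDbar j f z * cexp (a * f z) := by
  simp only [wDbar, fderiv_cexp_const_mul_apply a hf]
  ring

lemma fderiv_fderiv_apply (hf : ContDiff ℝ (⊤ : ℕ∞) f) (a : ℂ) (v v' w : Fin n → ℂ) :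
    fderiv ℝ (fun y => (fderiv ℝ f y v + a * fderiv ℝ f y v') / 2) z w =
      (fderiv ℝ (fderiv ℝ f) z w v + a * fderiv ℝ (fderiv ℝ f) z w v') / 2 := by
  have h : DifferentiableAt ℝ (fderiv ℝ f) z :=
    ((hf.fderiv_right (m := (⊤ : ℕ∞)) (by simp)).differentiable (by simp)) z
  have h' : ∀ v, HasFDerivAt (fun y => fderiv ℝ f y v)
      ((fderiv ℝ (fderiv ℝ f) z).flip v) z := fun v => by
    simpa using h.hasFDerivAt.clm_apply (hasFDerivAt_const v z)
  simp only [div_eq_mul_inv]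
  have h2 : HasFDerivAt (fun y => (fderiv ℝ f y v + a * fderiv ℝ f y v') * 2⁻¹) _ z :=
    (((h' v).add ((h' v').const_mul a)).mul_const (2⁻¹ : ℂ))
  rw [h2.fderiv]
  simp
  ring

lemma wDbar_wD_comm (hf : ContDiff ℝ (⊤ : ℕ∞) f) (j l : Fin n) :
    wDbar j (wD l f) z = wD l (wDbar j f) z := by
  have hs : IsSymmSndFDerivAt ℝ f z :=
    hf.contDiffAt.isSymmSndFDerivAt (by simpa using WithTop.coe_le_coe.2 (le_top (a := (2 : ℕ∞))))
  have h1 : wD l f = fun y => (fderiv ℝ f y (Pi.single l 1) +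
      (-Complex.I) * fderiv ℝ f y (Pi.single l Complex.I)) / 2 := by
    funext y; simp only [wD]; ring
  rw [h1]
  simp only [wD, wDbar]
  rw [fderiv_fderiv_apply hf, fderiv_fderiv_apply hf]
  unfold wDbar
  rw [fderiv_fderiv_apply hf, fderiv_fderiv_apply hf]
  rw [hs.eq (Pi.single j 1), hs.eq (Pi.single j 1), hs.eq (Pi.single j I), hs.eq (Pi.single j I)]
  ring

lemma integral_fderiv_apply_eq_zero (hf : ContDiff ℝ (⊤ : ℕ∞) f) (hc : HasCompactSupport f)
    (v : Fin n → ℂ) : ∫ z, fderiv ℝ f z v = 0 := by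
  have hf' : Continuous (fderiv ℝ f) := hf.continuous_fderiv (by simp)
  have h := integral_mul_fderiv_eq_neg_fderiv_mul_of_integrable (𝕜 := ℂ)
    (μ := (volume : Measure (Fin n → ℂ))) (f := fun _ => (1 : ℂ)) (g := f) (v := v)
    (by simp)
    (by simpa using (hf'.clm_apply continuous_const).integrable_of_hasCompactSupport
          (hc.fderiv_apply ℝ v))
    (by simpa using hf.continuous.integrable_of_hasCompactSupport hc)
    (by simp) (fun x _ => hf.differentiable (by simp) x)
  simpa using h

lemma HasCompactSupport.wD (hc : HasCompactSupport f) (j : Fin n) :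
    HasCompactSupport (wD j f) :=
  hc.mono' fun _ hz => not_not.1 fun h => hz (wD_eq_zero_of_notMem_tsupport j h)

lemma HasCompactSupport.wDbar (hc : HasCompactSupport f) (j : Fin n) :
    HasCompactSupport (wDbar j f) :=
  hc.mono' fun _ hz => not_not.1 fun h => hz (wDbar_eq_zero_of_notMem_tsupport j h)

lemma integrable_fderiv_apply (hf : ContDiff ℝ (⊤ : ℕ∞) f) (hc : HasCompactSupport f)
    (v : Fin n → ℂ) : Integrable fun z => fderiv ℝ f z v :=
  ((hf.continuous_fderiv (by simp)).clm_apply continuous_const).integrable_of_hasCompactSupport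
    (hc.fderiv_apply ℝ v)

lemma integral_wD_eq_zero (hf : ContDiff ℝ (⊤ : ℕ∞) f) (hc : HasCompactSupport f)
    (j : Fin n) : ∫ z, wD j f z = 0 := by
  simp only [wD]
  rw [integral_div, integral_sub (integrable_fderiv_apply hf hc _)
    ((integrable_fderiv_apply hf hc _).const_mul _), integral_const_mul,
    integral_fderiv_apply_eq_zero hf hc, integral_fderiv_apply_eq_zero hf hc]
  simp

lemma integral_wDbar_eq_zero (hf : ContDiff ℝ (⊤ : ℕ∞) f) (hc : HasCompactSupport f)
    (j : Fin n) : ∫ z, wDbar j f z = 0 := by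
  simp only [wDbar]
  rw [integral_div, integral_add (integrable_fderiv_apply hf hc _)
    ((integrable_fderiv_apply hf hc _).const_mul _), integral_const_mul,
    integral_fderiv_apply_eq_zero hf hc, integral_fderiv_apply_eq_zero hf hc]
  simp

/-- The twisted derivative `∂/∂z_j - 2k ∂g/∂z_j`, for which `e^{2kg} ∂/∂z_j (e^{-2kg} f)` is
another expression. -/
noncomputable def twistedD (k : ℝ) (g : (Fin n → ℂ) → ℂ) (j : Fin n) (f : (Fin n → ℂ) → ℂ) :
    (Fin n → ℂ) → ℂ :=
  fun z => wD j f z - 2 * k * wD j g z * f z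

lemma ContDiff.twistedD (k : ℝ) (hg : ContDiff ℝ (⊤ : ℕ∞) g) (hf : ContDiff ℝ (⊤ : ℕ∞) f)
    (j : Fin n) : ContDiff ℝ (⊤ : ℕ∞) (twistedD k g j f) := by
  have := hf.wD j
  have := hg.wD j
  unfold _root_.twistedD
  fun_prop

lemma wDbar_twistedD (k : ℝ) (hg : ContDiff ℝ (⊤ : ℕ∞) g) (hf : ContDiff ℝ (⊤ : ℕ∞) f)
    (j l : Fin n) : wDbar j (twistedD k g l f) z =
      twistedD k g l (wDbar j f) z - 2 * k * wDbar j (wD l g) z * f z := by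
  have h1 : DifferentiableAt ℝ f z := hf.differentiable (by simp) z
  have h2 : DifferentiableAt ℝ (wD l f) z := (hf.wD l).differentiable (by simp) z
  have h3 : DifferentiableAt ℝ (wD l g) z := (hg.wD l).differentiable (by simp) z
  unfold twistedD
  rw [wDbar_sub j h2 ((h3.const_mul _).fun_mul h1), wDbar_mul j (h3.const_mul _) h1,
    wDbar_const_mul j _ h3, wDbar_wD_comm hf]
  ring

lemma wD_sub_wDbar_eq (k : ℝ) {u v : (Fin n → ℂ) → ℂ} (hg : ContDiff ℝ (⊤ : ℕ∞) g)
    (hgr : ∀ z, conj (g z) = g z) (hu : ContDiff ℝ (⊤ : ℕ∞) u) (hv : ContDiff ℝ (⊤ : ℕ∞) v)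
    (j l : Fin n) :
    wD j (fun y => u y * cexp (-2 * k * g y) * conj (twistedD k g l v y)) z -
      wDbar l (fun y => u y * cexp (-2 * k * g y) * conj (wDbar j v y)) z =
    cexp (-2 * k * g z) * (twistedD k g j u z * conj (twistedD k g l v z) -
      wDbar l u z * conj (wDbar j v z) - 2 * k * (wD j (wDbar l g) z * u z * conj (v z))) := by
  have hg0 : DifferentiableAt ℝ g z := hg.differentiable (by simp) z
  have hu0 : DifferentiableAt ℝ u z := hu.differentiable (by simp) z
  have he : DifferentiableAt ℝ (fun y => cexp (-2 * k * g y)) z := (hg0.const_mul _).cexp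
  have ht : DifferentiableAt ℝ (twistedD k g l v) z :=
    (hg.twistedD k hv l).differentiable (by simp) z
  have hb : DifferentiableAt ℝ (wDbar j v) z := (hv.wDbar j).differentiable (by simp) z
  have hconj : (fun y => conj (g y)) = g := funext hgr
  have hg1 : ∀ y, conj (wD l g y) = wDbar l g y := fun y => by
    rw [← wDbar_conj l (hg.differentiable (by simp) y), hconj]
  have hg2 : conj (wDbar j (wD l g) z) = wD j (wDbar l g) z := by
    rw [← wD_conj j ((hg.wD l).differentiable (by simp) z), funext hg1]
  rw [wD_mul j (hu0.fun_mul he) (by fun_prop), wDbar_mul l (hu0.fun_mul he) (by fun_prop),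
    wD_mul j hu0 he, wDbar_mul l hu0 he, wD_cexp_const_mul j _ hg0, wDbar_cexp_const_mul l _ hg0,
    wD_conj j ht, wDbar_conj l hb, wDbar_twistedD k hg hv]
  simp only [twistedD, map_sub, map_mul, hg1, hg2, conj_ofReal, map_ofNat]
  ring

end Wirtinger

lemma sum_sum_lt_eq_half {n : ℕ} (f : Fin n → Fin n → ℝ) (hs : ∀ j l, f j l = f l j)
    (h0 : ∀ j, f j j = 0) :
    2 * (∑ j, ∑ l, if j < l then f j l else 0) = ∑ j, ∑ l, f j l := by
  have h1 : (∑ j, ∑ l, if j < l then f j l else 0) = ∑ j, ∑ l, if l < j then f j l else 0 := by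
    rw [Finset.sum_comm]
    simp only [hs]
  rw [two_mul]
  nth_rw 2 [h1]
  simp only [← Finset.sum_add_distrib]
  refine Finset.sum_congr rfl fun j _ => Finset.sum_congr rfl fun l _ => ?_
  rcases lt_trichotomy j l with h | rfl | h
  · simp [h, h.not_gt]
  · simp [h0]
  · simp [h, h.not_gt]

lemma sum_sum_lt_norm_sub_sq {n : ℕ} (a : Fin n → Fin n → ℂ) :
    (∑ j, ∑ l, if j < l then ‖a j l - a l j‖ ^ 2 else 0) =
      ∑ j, ∑ l, ‖a j l‖ ^ 2 - (∑ j, ∑ l, a l j * conj (a j l)).re := by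
  have h := sum_sum_lt_eq_half (fun j l => ‖a j l - a l j‖ ^ 2)
    (fun j l => by rw [norm_sub_rev]) (by simp)
  have h2 : ∀ j l, ‖a j l - a l j‖ ^ 2 =
      ‖a j l‖ ^ 2 + ‖a l j‖ ^ 2 - 2 * (a l j * conj (a j l)).re := fun j l => by
    simp only [← Complex.normSq_eq_norm_sq, Complex.normSq_sub]
    rw [← conj_re (a j l * _), map_mul, conj_conj, mul_comm (a l j)]
  simp only [h2, Finset.sum_sub_distrib, Finset.sum_add_distrib, ← Finset.mul_sum] at h
  rw [Finset.sum_comm (f := fun j l => ‖a l j‖ ^ 2)] at h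
  simp only [h2, re_sum]
  linarith

lemma norm_sum_sq {ι : Type*} (s : Finset ι) (d : ι → ℂ) :
    ‖∑ j ∈ s, d j‖ ^ 2 = (∑ j ∈ s, ∑ l ∈ s, d j * conj (d l)).re := by
  rw [← Complex.normSq_eq_norm_sq, ← ofReal_re (normSq _), ← mul_conj, map_sum,
    Finset.sum_mul_sum]

lemma norm_sq_mul_exp_le {n : ℕ} (k c : ℝ) (hk : 0 < k) {φ : (Fin n → ℂ) → ℝ}
    (hφ : ContDiff ℝ (⊤ : ℕ∞) φ) {u : Fin n → (Fin n → ℂ) → ℂ}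
    (hu : ∀ j, ContDiff ℝ (⊤ : ℕ∞) (u j)) (z : Fin n → ℂ)
    (hHess : c * ∑ j, ‖u j z‖ ^ 2 ≤
      (∑ j, ∑ l, wD j (wDbar l (fun y => (φ y : ℂ))) z * u j z * conj (u l z)).re) :
    2 * k * c * ∑ j, ‖u j z‖ ^ 2 * Real.exp (-2 * k * φ z) +
      (∑ j, ∑ l,
        (wD j (fun y => u j y * cexp (-2 * k * φ y) *
            conj (twistedD k (fun y => (φ y : ℂ)) l (u l) y)) z -
          wDbar l (fun y => u j y * cexp (-2 * k * φ y) * conj (wDbar j (u l) y)) z)).re ≤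
      (∑ j, ∑ l, if j < l then
          ‖wDbar j (u l) z - wDbar l (u j) z‖ ^ 2 * Real.exp (-2 * k * φ z) else 0) +
        ‖∑ j, (wD j (u j) z - 2 * k * wD j (fun y => (φ y : ℂ)) z * u j z)‖ ^ 2 *
          Real.exp (-2 * k * φ z) := by
  have hg : ContDiff ℝ (⊤ : ℕ∞) (fun y => (φ y : ℂ)) := ofRealCLM.contDiff.comp hφ
  have he : cexp (-2 * k * φ z) = (Real.exp (-2 * k * φ z) : ℝ) := by push_cast; rfl
  set r := Real.exp (-2 * k * φ z)
  have hr0 : 0 ≤ r := (Real.exp_pos _).le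
  have hsum : (∑ j, ∑ l, if j < l then
      ‖wDbar j (u l) z - wDbar l (u j) z‖ ^ 2 * r else 0) =
      (∑ j, ∑ l, if j < l then ‖wDbar j (u l) z - wDbar l (u j) z‖ ^ 2 else 0) * r := by
    simp only [Finset.sum_mul, ite_mul, zero_mul]
  have hdiv := fun j l => wD_sub_wDbar_eq (z := z) k hg (fun z => conj_ofReal _) (hu j) (hu l) j l
  have ht : ∀ j, wD j (u j) z - 2 * k * wD j (fun y => (φ y : ℂ)) z * u j z =
      twistedD k (fun y => (φ y : ℂ)) j (u j) z := fun j => rfl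
  simp only [hdiv, ht]
  rw [hsum, sum_sum_lt_norm_sub_sq (fun j l => wDbar j (u l) z), norm_sum_sq]
  simp only [he, ← Finset.mul_sum, ← Finset.sum_mul, Finset.sum_sub_distrib, re_ofReal_mul, sub_re]
  have h2 : ∀ w : ℂ, (2 * (k : ℂ) * w).re = 2 * k * w.re := fun w => by
    rw [← re_ofReal_mul]; push_cast; rfl
  rw [h2]
  have hnn : 0 ≤ ∑ j, ∑ l, ‖wDbar j (u l) z‖ ^ 2 := by positivity
  have hH := mul_le_mul_of_nonneg_left hHess (by positivity : 0 ≤ 2 * k * r)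
  nlinarith [mul_nonneg hr0 hnn]

section Integral

variable {n : ℕ} {φ : (Fin n → ℂ) → ℝ} {u : Fin n → (Fin n → ℂ) → ℂ}

lemma integrable_norm_sq_mul_exp (k : ℝ) (hφ : Continuous φ) {f : (Fin n → ℂ) → ℂ}
    (hf : Continuous f) (hc : HasCompactSupport f) :
    Integrable fun z => ‖f z‖ ^ 2 * Real.exp (-2 * k * φ z) := by
  refine Continuous.integrable_of_hasCompactSupport (by fun_prop) ?_
  refine hc.mono fun z hz h => hz ?_
  simp [h]

lemma integrable_and_integral_re_sum_wD_sub_wDbar_eq_zero {F G : Fin n → Fin n → (Fin n → ℂ) → ℂ}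
    (hF : ∀ j l, ContDiff ℝ (⊤ : ℕ∞) (F j l)) (hFc : ∀ j l, HasCompactSupport (F j l))
    (hG : ∀ j l, ContDiff ℝ (⊤ : ℕ∞) (G j l)) (hGc : ∀ j l, HasCompactSupport (G j l)) :
    Integrable (fun z => (∑ j, ∑ l, (wD j (F j l) z - wDbar l (G j l) z)).re) ∧
      ∫ z, (∑ j, ∑ l, (wD j (F j l) z - wDbar l (G j l) z)).re = 0 := by
  have h1 : ∀ j l, Integrable (wD j (F j l)) := fun j l =>
    ((hF j l).wD j).continuous.integrable_of_hasCompactSupport ((hFc j l).wD j)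
  have h2 : ∀ j l, Integrable (wDbar l (G j l)) := fun j l =>
    ((hG j l).wDbar l).continuous.integrable_of_hasCompactSupport ((hGc j l).wDbar l)
  have h12 : ∀ j l, Integrable (fun z => wD j (F j l) z - wDbar l (G j l) z) := fun j l =>
    (h1 j l).sub (h2 j l)
  have h3 : Integrable (fun z => ∑ j, ∑ l, (wD j (F j l) z - wDbar l (G j l) z)) :=
    integrable_finsetSum _ fun j _ => integrable_finsetSum _ fun l _ => h12 j l
  refine ⟨h3.re, ?_⟩
  refine (integral_re h3).trans ?_
  rw [integral_finsetSum _ fun j _ => integrable_finsetSum _ fun l _ => h12 j l]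
  simp_rw [integral_finsetSum _ fun l _ => h12 _ l, integral_sub (h1 _ _) (h2 _ _),
    integral_wD_eq_zero (hF _ _) (hFc _ _), integral_wDbar_eq_zero (hG _ _) (hGc _ _)]
  simp

/-- The basic estimate on all of `ℂⁿ`, for a globally smooth weight. -/
lemma integral_norm_sq_mul_exp_le (k c : ℝ) (hk : 0 < k) (hφ : ContDiff ℝ (⊤ : ℕ∞) φ)
    (hu : ∀ j, ContDiff ℝ (⊤ : ℕ∞) (u j)) (huc : ∀ j, HasCompactSupport (u j))
    (hHess : ∀ z, c * ∑ j, ‖u j z‖ ^ 2 ≤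
      (∑ j, ∑ l, wD j (wDbar l (fun y => (φ y : ℂ))) z * u j z * conj (u l z)).re) :
    2 * k * c * ∑ j, ∫ z, ‖u j z‖ ^ 2 * Real.exp (-2 * k * φ z) ≤
      (∑ j, ∑ l, if j < l then
          ∫ z, ‖wDbar j (u l) z - wDbar l (u j) z‖ ^ 2 * Real.exp (-2 * k * φ z) else 0) +
        ∫ z, ‖∑ j, (wD j (u j) z - 2 * k * wD j (fun y => (φ y : ℂ)) z * u j z)‖ ^ 2 *
          Real.exp (-2 * k * φ z) := by
  have hg : ContDiff ℝ (⊤ : ℕ∞) (fun y => (φ y : ℂ)) := ofRealCLM.contDiff.comp hφ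
  have hcg (j l) : Continuous (wDbar j (u l)) := ((hu l).wDbar j).continuous
  have hcd (j) : Continuous (wD j (u j)) := ((hu j).wD j).continuous
  have hcφ (j) : Continuous (wD j (fun y => (φ y : ℂ))) := (hg.wD j).continuous
  have hcu (j) : Continuous (u j) := (hu j).continuous
  have hU (j) : Integrable fun z => ‖u j z‖ ^ 2 * Real.exp (-2 * k * φ z) :=
    integrable_norm_sq_mul_exp k hφ.continuous (hcu j) (huc j)
  have hA (j l) : Integrable fun z =>
      ‖wDbar j (u l) z - wDbar l (u j) z‖ ^ 2 * Real.exp (-2 * k * φ z) :=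
    integrable_norm_sq_mul_exp k hφ.continuous ((hcg j l).sub (hcg l j))
      (((huc l).wDbar j).sub ((huc j).wDbar l))
  have hA' (j l) : Integrable fun z => if j < l then
      ‖wDbar j (u l) z - wDbar l (u j) z‖ ^ 2 * Real.exp (-2 * k * φ z) else 0 := by
    split_ifs
    · exact hA j l
    · exact integrable_zero _ _ _
  have hB : Integrable fun z =>
      ‖∑ j, (wD j (u j) z - 2 * k * wD j (fun y => (φ y : ℂ)) z * u j z)‖ ^ 2 *
        Real.exp (-2 * k * φ z) := by
    refine integrable_norm_sq_mul_exp k hφ.continuous (by fun_prop) ?_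
    refine HasCompactSupport.intro (isCompact_iUnion fun j => huc j) fun z hz => ?_
    simp only [Set.mem_iUnion, not_exists] at hz
    refine Finset.sum_eq_zero fun j _ => ?_
    rw [wD_eq_zero_of_notMem_tsupport j (hz j), image_eq_zero_of_notMem_tsupport (hz j)]
    simp
  have hF (j l) : ContDiff ℝ (⊤ : ℕ∞) (fun y => u j y * cexp (-2 * k * φ y) *
      conj (twistedD k (fun y => (φ y : ℂ)) l (u l) y)) :=
    ((hu j).mul (contDiff_const.mul hg).cexp).mul (conjCLE.contDiff.comp (hg.twistedD k (hu l) l))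
  have hG (j l) : ContDiff ℝ (⊤ : ℕ∞) (fun y => u j y * cexp (-2 * k * φ y) *
      conj (wDbar j (u l) y)) :=
    ((hu j).mul (contDiff_const.mul hg).cexp).mul (conjCLE.contDiff.comp ((hu l).wDbar j))
  obtain ⟨hE, hE0⟩ := integrable_and_integral_re_sum_wD_sub_wDbar_eq_zero hF
    (fun j l => ((huc j).mul_right).mul_right) hG (fun j l => ((huc j).mul_right).mul_right)
  have hUs := (integrable_finsetSum Finset.univ fun j _ => hU j).const_mul (2 * k * c)
  have hAs := integrable_finsetSum Finset.univ fun j _ =>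
    integrable_finsetSum Finset.univ fun l _ => hA' j l
  have h := integral_mono (hUs.add hE) (hAs.add hB)
    fun z => norm_sq_mul_exp_le k c hk hφ hu z (hHess z)
  simp only [Pi.add_apply] at h
  rw [integral_add hUs hE, integral_add hAs hB, hE0, add_zero, integral_const_mul,
    integral_finsetSum _ fun j _ => hU j,
    integral_finsetSum _ fun j _ => integrable_finsetSum _ fun l _ => hA' j l] at h
  simp_rw [integral_finsetSum _ fun l _ => hA' _ l] at h
  refine h.trans_eq ?_
  congr 1
  refine Finset.sum_congr rfl fun j _ => Finset.sum_congr rfl fun l _ => ?_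
  split_ifs <;> simp

end Integral

open scoped Manifold in
/-- A function that is smooth on an open set agrees near a given compact subset with a function
that is smooth everywhere. -/
lemma ContDiffOn.exists_contDiff_eventuallyEq {E : Type*} [NormedAddCommGroup E] [NormedSpace ℝ E]
    [FiniteDimensional ℝ E] {U K : Set E} {φ : E → ℝ} (hφ : ContDiffOn ℝ (⊤ : ℕ∞) φ U)
    (hU : IsOpen U) (hK : IsCompact K) (hKU : K ⊆ U) :
    ∃ ψ : E → ℝ, ContDiff ℝ (⊤ : ℕ∞) ψ ∧ ∀ z ∈ K, ψ =ᶠ[nhds z] φ := by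
  obtain ⟨L, hL, hKL, hLU⟩ := exists_compact_between hK hU hKU
  obtain ⟨χ, h1, h0, -⟩ := exists_contMDiffMap_one_nhds_of_subset_interior (n := (⊤ : ℕ∞))
    𝓘(ℝ, E) hK.isClosed hKL
  have hχ : ContDiff ℝ (⊤ : ℕ∞) χ := χ.contMDiff.contDiff
  refine ⟨fun z => χ z * φ z, contDiff_iff_contDiffAt.2 fun z => ?_, fun z hz => ?_⟩
  · by_cases hz : z ∈ U
    · exact hχ.contDiffAt.mul (hφ.contDiffAt (hU.mem_nhds hz))
    · refine (contDiffAt_const (c := (0 : ℝ))).congr_of_eventuallyEq ?_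
      filter_upwards [hL.isClosed.isOpen_compl.mem_nhds fun h => hz (hLU h)] with y hy
      simp [h0 y hy]
  · filter_upwards [Filter.Eventually.filter_mono (nhds_le_nhdsSet hz) h1] with y hy
    simp [hy]

/-- the local spectral gap (basic a priori estimate) for the weighted
`∂̄`-complex on `(0,1)`-forms with compactly supported smooth coefficients. -/
theorem stmt_10 {n : ℕ} (U : Set (Fin n → ℂ)) (hU : IsOpen U)
    (φ : (Fin n → ℂ) → ℝ) (hφ : ContDiffOn ℝ (⊤ : ℕ∞) φ U)
    (k c : ℝ) (hk : 0 < k) (hc : 0 < c)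
    (dlam : Measure (Fin n → ℂ)) (hdlam : dlam = (2 ^ n : ℝ≥0∞) • volume)
    (hHess : ∀ z ∈ U, ∀ w : Fin n → ℂ,
      c * ∑ j, ‖w j‖ ^ 2 ≤
        (∑ j, ∑ ℓ, wD j (wDbar ℓ (fun y => (φ y : ℂ))) z * w j * conj (w ℓ)).re)
    (u : Fin n → (Fin n → ℂ) → ℂ)
    (hu : ∀ j, ContDiff ℝ (⊤ : ℕ∞) (u j) ∧ HasCompactSupport (u j) ∧ tsupport (u j) ⊆ U) :
    2 * k * c * ∑ j, ∫ z in U, ‖u j z‖ ^ 2 * Real.exp (-2 * k * φ z) ∂dlam ≤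
      (∑ j, ∑ ℓ, if j < ℓ then
          ∫ z in U, ‖wDbar j (u ℓ) z - wDbar ℓ (u j) z‖ ^ 2 * Real.exp (-2 * k * φ z) ∂dlam
        else 0)
      + ∫ z in U,
          ‖∑ j, (wD j (u j) z - 2 * k * wD j (fun y => (φ y : ℂ)) z * u j z)‖ ^ 2 *
            Real.exp (-2 * k * φ z) ∂dlam := by
  subst hdlam
  set K : Set (Fin n → ℂ) := ⋃ j, tsupport (u j)
  have hK : IsCompact K := isCompact_iUnion fun j => (hu j).2.1
  have hKU : K ⊆ U := Set.iUnion_subset fun j => (hu j).2.2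
  obtain ⟨ψ, hψ, hψφ⟩ := hφ.exists_contDiff_eventuallyEq hU hK hKU
  have hψφ' : ∀ z ∈ K, (fun y => (ψ y : ℂ)) =ᶠ[nhds z] fun y => (φ y : ℂ) := fun z hz =>
    (hψφ z hz).fun_comp ((↑) : ℝ → ℂ)
  have hu0 : ∀ z ∉ K, ∀ j, z ∉ tsupport (u j) := fun z hz j h => hz (Set.mem_iUnion.2 ⟨j, h⟩)
  have hmain := integral_norm_sq_mul_exp_le (u := u) k c hk hψ (fun j => (hu j).1)
    (fun j => (hu j).2.1) fun z => by
      by_cases hz : z ∈ K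
      · have h := hHess z (hKU hz) (fun j => u j z)
        simpa only [((hψφ' z hz).wDbar _).wD_eq] using h
      · simp [image_eq_zero_of_notMem_tsupport (hu0 z hz _)]
  have hint : ∀ f g : (Fin n → ℂ) → ℂ, (∀ z ∉ K, f z = 0) → (∀ z ∉ K, g z = 0) →
      (∀ z ∈ K, f z = g z) →
      ∫ z in U, ‖f z‖ ^ 2 * Real.exp (-2 * k * φ z) ∂((2 ^ n : ℝ≥0∞) • volume) =
        2 ^ n * ∫ z, ‖g z‖ ^ 2 * Real.exp (-2 * k * ψ z) := fun f g hf hg hfg => by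
    rw [Measure.restrict_smul, integral_smul_measure,
      setIntegral_eq_integral_of_forall_compl_eq_zero fun z hz => by
        simp [hf z fun h => hz (hKU h)]]
    simp only [ENNReal.toReal_pow, ENNReal.toReal_ofNat, smul_eq_mul]
    congr 2
    funext z
    by_cases hz : z ∈ K
    · rw [hfg z hz, (hψφ z hz).eq_of_nhds]
    · simp [hf z hz, hg z hz]
  have h1 : ∀ j, _ := fun j => hint (u j) (u j)
    (fun z hz => image_eq_zero_of_notMem_tsupport (hu0 z hz j))
    (fun z hz => image_eq_zero_of_notMem_tsupport (hu0 z hz j)) fun z _ => rfl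
  have h2' : ∀ j l, ∀ z ∉ K, wDbar j (u l) z - wDbar l (u j) z = 0 := fun j l z hz => by
    rw [wDbar_eq_zero_of_notMem_tsupport j (hu0 z hz l),
      wDbar_eq_zero_of_notMem_tsupport l (hu0 z hz j), sub_zero]
  have h2 : ∀ j l, _ := fun j l => hint (fun z => wDbar j (u l) z - wDbar l (u j) z) _
    (h2' j l) (h2' j l) fun z _ => rfl
  have h3' : ∀ θ : (Fin n → ℂ) → ℝ, ∀ z ∉ K,
      ∑ j, (wD j (u j) z - 2 * k * wD j (fun y => (θ y : ℂ)) z * u j z) = 0 := fun θ z hz =>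
    Finset.sum_eq_zero fun j _ => by
      rw [wD_eq_zero_of_notMem_tsupport j (hu0 z hz j),
        image_eq_zero_of_notMem_tsupport (hu0 z hz j), mul_zero, sub_zero]
  have h3 := hint
    (fun z => ∑ j, (wD j (u j) z - 2 * k * wD j (fun y => (φ y : ℂ)) z * u j z))
    (fun z => ∑ j, (wD j (u j) z - 2 * k * wD j (fun y => (ψ y : ℂ)) z * u j z))
    (h3' φ) (h3' ψ) fun z hz => by simp only [(hψφ' z hz).wD_eq]
  rw [h3]
  simp only [h1, h2]
  have h := mul_le_mul_of_nonneg_left hmain (by positivity : (0 : ℝ) ≤ 2 ^ n)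
  rw [mul_add] at h
  simp only [Finset.mul_sum, mul_ite, mul_zero] at h ⊢
  exact (Finset.sum_congr rfl fun j _ => by ring).trans_le h
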